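/- Let A ∈ ℝ^{m×n} be an arbitrary matrix and x* a nonnegative vector supported on a set S with |S| = k. Then x* is the unique solution of {x : Ax = Ax*, x ≥ 0} if and only if there is no nonzero vector v in the null space of A with all its negative components contained in S (i.e., v_j ≥ 0 for all j ∉ S). -/

import Mathlib

open Matrix

/-- A nonnegative vector can be moved a positive distance along any direction that is nonnegative
where the vector vanishes, without leaving the nonnegative orthant. -/
theorem exists_pos_nonneg_add_smul {ι : Type*} [Finite ι] {x v : ι → ℝ} (hx : 0 ≤ x)
    (hv : ∀ j, x j = 0 → 0 ≤ v j) : ∃ ε : ℝ, 0 < ε ∧ 0 ≤ x + ε • v := by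
  have hev : ∀ᶠ ε : ℝ in nhdsWithin 0 (Set.Ioi 0), ∀ j, 0 ≤ x j + ε * v j := by
    refine Filter.eventually_all.2 fun j => ?_
    rcases (hx j).eq_or_lt with hj | hj
    · filter_upwards [self_mem_nhdsWithin] with ε hε
      exact add_nonneg (hx j) (mul_nonneg (le_of_lt hε) (hv j hj.symm))
    · have hcont : Continuous fun ε : ℝ => x j + ε * v j := by fun_prop
      have hpos : ∀ᶠ ε : ℝ in nhds 0, 0 < x j + ε * v j :=
        hcont.continuousAt.eventually (lt_mem_nhds (by simpa using hj))
      filter_upwards [nhdsWithin_le_nhds hpos] with ε hε using le_of_lt hε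
  obtain ⟨ε, hε, hε_pos⟩ := (hev.and self_mem_nhdsWithin).exists
  exact ⟨ε, hε_pos, fun j => hε j⟩

/-- a nonnegative vector `x*` supported on `S`, `|S| = k`, is the
unique solution of `{x : Ax = Ax*, x ≥ 0}` iff no nonzero null space vector has
all its negative components in `S`. -/
theorem stmt2 {m n k : ℕ} (A : Matrix (Fin m) (Fin n) ℝ)
    (xstar : Fin n → ℝ) (hx : 0 ≤ xstar) (S : Finset (Fin n))
    (hS : ∀ j, j ∈ S ↔ xstar j ≠ 0) (hcard : S.card = k) :
    {x : Fin n → ℝ | A.mulVec x = A.mulVec xstar ∧ 0 ≤ x} = {xstar} ↔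
      ¬ ∃ v : Fin n → ℝ, v ≠ 0 ∧ A.mulVec v = 0 ∧ ∀ j ∉ S, 0 ≤ v j := by
  constructor
  · rintro hunique ⟨v, hv_ne, hv_ker, hv_nonneg⟩
    obtain ⟨ε, hε, hfeas⟩ := exists_pos_nonneg_add_smul hx
      fun j hj => hv_nonneg j fun hjS => (hS j).1 hjS hj
    have hmem : xstar + ε • v ∈ {x : Fin n → ℝ | A.mulVec x = A.mulVec xstar ∧ 0 ≤ x} :=
      ⟨by rw [mulVec_add, mulVec_smul, hv_ker, smul_zero, add_zero], hfeas⟩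
    rw [hunique, Set.mem_singleton_iff, add_eq_left, smul_eq_zero] at hmem
    exact hmem.elim hε.ne' hv_ne
  · intro hnone
    refine Set.eq_singleton_iff_unique_mem.2 ⟨⟨rfl, hx⟩, fun x ⟨hAx, hx_nonneg⟩ => ?_⟩
    by_contra hne
    refine hnone ⟨x - xstar, sub_ne_zero.2 hne, by rw [mulVec_sub, hAx, sub_self], fun j hj => ?_⟩
    have hzero : xstar j = 0 := by_contra fun h => hj ((hS j).2 h)
    simpa [hzero] using hx_nonneg j
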